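/- arXiv:1904.07267 — 3 statements merged into one kernel-verified Lean document; each statement's English description precedes it below -/
import Mathlib

section
/- For every d ≥ 1, the subspace of vectors v ∈ ℂ^d ⊗ ℂ^d satisfying (U ⊗ Ū) v = v for every unitary U ∈ U(d) is exactly the one-dimensional span of |Φ⁺⟩, and the Haar integral ∫ U ⊗ Ū dμ(U) over U(d) with the Haar probability measure μ equals the projection Φ⁺ = |Φ⁺⟩⟨Φ⁺|. -/
open Matrix MeasureTheory
open scoped Kronecker

/-- The maximally entangled vector `|Φ⁺⟩ = (1/√d) ∑ⱼ |j⟩⊗|j⟩` on `ℂ^d ⊗ ℂ^d`. -/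
noncomputable def mesVec (ι : Type*) [Fintype ι] [DecidableEq ι] : ι × ι → ℂ :=
  fun p => if p.1 = p.2 then (((Real.sqrt (Fintype.card ι))⁻¹ : ℝ) : ℂ) else 0

/-- The rank-one projection `Φ⁺ = |Φ⁺⟩⟨Φ⁺|`. -/
noncomputable def mesProj (ι : Type*) [Fintype ι] [DecidableEq ι] :
    Matrix (ι × ι) (ι × ι) ℂ :=
  Matrix.vecMulVec (mesVec ι) (star (mesVec ι))

/-- Action of `U ⊗ Ū` on a vector, written as a double sum. -/
lemma kron_mulVec_apply {d : ℕ} (U : Matrix (Fin d) (Fin d) ℂ) (v : Fin d × Fin d → ℂ)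
    (i k : Fin d) :
    (U ⊗ₖ U.map (starRingEnd ℂ)).mulVec v (i, k)
      = ∑ j, ∑ l, U i j * (starRingEnd ℂ) (U k l) * v (j, l) := by
  simp [Matrix.mulVec, dotProduct, Fintype.sum_prod_type, Matrix.kroneckerMap_apply]

lemma offdiag_zero {d : ℕ} (v : Fin d × Fin d → ℂ)
    (h : ∀ U ∈ Matrix.unitaryGroup (Fin d) ℂ,
        (U ⊗ₖ U.map (starRingEnd ℂ)).mulVec v = v) (i k : Fin d) (hik : i ≠ k) :
    v (i, k) = 0 := by
  have hU : Matrix.diagonal (fun j : Fin d => if j = i then (-1 : ℂ) else 1)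
      ∈ Matrix.unitaryGroup (Fin d) ℂ := by
    rw [Matrix.mem_unitaryGroup_iff, Matrix.star_eq_conjTranspose,
      Matrix.diagonal_conjTranspose, Matrix.diagonal_mul_diagonal, ← Matrix.diagonal_one]
    congr 1
    funext j
    by_cases hj : j = i <;> simp [hj]
  have h1 := congrFun (h _ hU) (i, k)
  rw [kron_mulVec_apply] at h1
  simp [Matrix.diagonal_apply, hik.symm, apply_ite (starRingEnd ℂ), ite_mul, mul_ite] at h1
  have h2 : -v (i, k) = v (i, k) := by simpa using h1
  linear_combination (-1 / 2 : ℂ) * h2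

lemma diag_eq {d : ℕ} (v : Fin d × Fin d → ℂ)
    (h : ∀ U ∈ Matrix.unitaryGroup (Fin d) ℂ,
        (U ⊗ₖ U.map (starRingEnd ℂ)).mulVec v = v) (i k : Fin d) :
    v (i, i) = v (k, k) := by
  have hU : (Matrix.of fun a b : Fin d => if Equiv.swap i k a = b then (1 : ℂ) else 0)
      ∈ Matrix.unitaryGroup (Fin d) ℂ := by
    rw [Matrix.mem_unitaryGroup_iff]
    ext a b
    simp [Matrix.mul_apply, Matrix.star_apply, Matrix.one_apply, apply_ite (starRingEnd ℂ),
      eq_comm]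
  have h1 := congrFun (h _ hU) (i, i)
  rw [kron_mulVec_apply] at h1
  simp [apply_ite (starRingEnd ℂ), ite_mul] at h1
  exact h1.symm

lemma mesVec_fixed {d : ℕ} (U : Matrix (Fin d) (Fin d) ℂ)
    (hU : U ∈ Matrix.unitaryGroup (Fin d) ℂ) :
    (U ⊗ₖ U.map (starRingEnd ℂ)).mulVec (mesVec (Fin d)) = mesVec (Fin d) := by
  funext ⟨i, k⟩
  rw [kron_mulVec_apply]
  have h := congrFun (congrFun (Matrix.mem_unitaryGroup_iff.mp hU) i) k
  rw [Matrix.mul_apply] at h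
  simp only [Matrix.star_apply, Matrix.one_apply] at h
  simp only [mesVec, mul_ite, mul_zero, Finset.sum_ite_eq, Finset.mem_univ, if_true]
  rw [← Finset.sum_mul]
  simp only [starRingEnd_apply]
  rw [h]
  split_ifs <;> simp

lemma fixed_mem_span {d : ℕ} (hd : 1 ≤ d) (v : Fin d × Fin d → ℂ)
    (h : ∀ U ∈ Matrix.unitaryGroup (Fin d) ℂ,
        (U ⊗ₖ U.map (starRingEnd ℂ)).mulVec v = v) :
    ∃ c : ℂ, c • mesVec (Fin d) = v := by
  have hs : ((Real.sqrt d : ℝ) : ℂ) ≠ 0 := by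
    have : (0 : ℝ) < d := by exact_mod_cast hd
    exact_mod_cast (Real.sqrt_pos.mpr this).ne'
  refine ⟨v (⟨0, hd⟩, ⟨0, hd⟩) * (Real.sqrt d : ℝ), ?_⟩
  funext ⟨i, k⟩
  by_cases hik : i = k
  · subst hik
    rw [diag_eq v h i ⟨0, hd⟩]
    simp [mesVec, mul_assoc, hs]
  · rw [offdiag_zero v h i k hik]
    simp [mesVec, hik]

lemma mesVec_norm {d : ℕ} (hd : 1 ≤ d) :
    ∑ p, star (mesVec (Fin d) p) * mesVec (Fin d) p = 1 := by
  have h0 : (0 : ℝ) < d := by exact_mod_cast hd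
  have h1 : ((d : ℝ) : ℂ) * ((((Real.sqrt d)⁻¹ : ℝ) : ℂ) * (((Real.sqrt d)⁻¹ : ℝ) : ℂ)) = 1 := by
    rw [← Complex.ofReal_mul, ← Complex.ofReal_mul, ← mul_inv, Real.mul_self_sqrt h0.le,
      mul_inv_cancel₀ h0.ne', Complex.ofReal_one]
  simp only [Fintype.sum_prod_type, mesVec, mul_ite, mul_zero, Finset.sum_ite_eq,
    Finset.mem_univ, if_true, Complex.star_def, Complex.conj_ofReal, Fintype.card_fin,
    Finset.sum_const, Finset.card_univ, nsmul_eq_mul]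
  exact_mod_cast h1

lemma mesVec_left_fixed {d : ℕ} (U : Matrix (Fin d) (Fin d) ℂ)
    (hU : U ∈ Matrix.unitaryGroup (Fin d) ℂ) (q : Fin d × Fin d) :
    ∑ p, star (mesVec (Fin d) p) * (U ⊗ₖ U.map (starRingEnd ℂ)) p q
      = star (mesVec (Fin d) q) := by
  obtain ⟨j, l⟩ := q
  have h := congrFun (congrFun (Matrix.mem_unitaryGroup_iff'.mp hU) l) j
  rw [Matrix.mul_apply] at h
  simp only [Matrix.star_apply, Matrix.one_apply] at h
  simp only [Fintype.sum_prod_type, mesVec, apply_ite star, star_zero, ite_mul, zero_mul,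
    Finset.sum_ite_eq, Finset.mem_univ, if_true, Matrix.kroneckerMap_apply, Matrix.map_apply,
    starRingEnd_apply]
  rw [← Finset.mul_sum]
  simp only [mul_comm (U _ j)]
  rw [h]
  by_cases hjl : j = l
  · simp [hjl]
  · simp [hjl, Ne.symm hjl]

lemma kron_conj_mul {d : ℕ} (W U : Matrix (Fin d) (Fin d) ℂ) :
    (W * U) ⊗ₖ (W * U).map (starRingEnd ℂ)
      = (W ⊗ₖ W.map (starRingEnd ℂ)) * (U ⊗ₖ U.map (starRingEnd ℂ)) := by
  rw [Matrix.map_mul, Matrix.mul_kronecker_mul]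

lemma entry_integrable {d : ℕ}
    [MeasurableSpace (Matrix.unitaryGroup (Fin d) ℂ)]
    [BorelSpace (Matrix.unitaryGroup (Fin d) ℂ)]
    (μ : Measure (Matrix.unitaryGroup (Fin d) ℂ)) [IsProbabilityMeasure μ]
    (p q : Fin d × Fin d) :
    Integrable (fun U : Matrix.unitaryGroup (Fin d) ℂ =>
      ((U : Matrix (Fin d) (Fin d) ℂ) ⊗ₖ
            (U : Matrix (Fin d) (Fin d) ℂ).map (starRingEnd ℂ)) p q) μ := by
  refine Integrable.of_bound (C := 1) ?_ ?_
  · refine Continuous.aestronglyMeasurable ?_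
    have hc : ∀ i j : Fin d, Continuous
        (fun U : Matrix.unitaryGroup (Fin d) ℂ => (U : Matrix (Fin d) (Fin d) ℂ) i j) :=
      fun i j => continuous_subtype_val.matrix_elem i j
    exact (hc _ _).mul (Complex.continuous_conj.comp (hc _ _))
  · refine Filter.Eventually.of_forall fun U => ?_
    simp only [Matrix.kroneckerMap_apply, Matrix.map_apply, norm_mul, RCLike.norm_conj]
    exact mul_le_one₀ (entry_norm_bound_of_unitary U.2 _ _) (norm_nonneg _)
      (entry_norm_bound_of_unitary U.2 _ _)

/-- The subspace of vectors of `ℂ^d ⊗ ℂ^d` fixed by `U ⊗ Ū` for all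
unitaries `U ∈ U(d)` is exactly the span of `|Φ⁺⟩`, and the Haar integral
`∫ U ⊗ Ū dμ(U)` over `U(d)` (μ the Haar probability measure, entrywise integral)
equals the projection `Φ⁺ = |Φ⁺⟩⟨Φ⁺|`. -/
theorem fixed_vectors_and_haar_average (d : ℕ) (hd : 1 ≤ d)
    [MeasurableSpace (Matrix.unitaryGroup (Fin d) ℂ)]
    [BorelSpace (Matrix.unitaryGroup (Fin d) ℂ)]
    (μ : Measure (Matrix.unitaryGroup (Fin d) ℂ))
    [μ.IsHaarMeasure] [IsProbabilityMeasure μ] :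
    ({v : Fin d × Fin d → ℂ | ∀ U ∈ Matrix.unitaryGroup (Fin d) ℂ,
        (U ⊗ₖ U.map (starRingEnd ℂ)).mulVec v = v}
      = ↑(Submodule.span ℂ ({mesVec (Fin d)} : Set (Fin d × Fin d → ℂ)))) ∧
    ∀ p q : Fin d × Fin d,
      (∫ U : Matrix.unitaryGroup (Fin d) ℂ,
          ((U : Matrix (Fin d) (Fin d) ℂ) ⊗ₖ
            (U : Matrix (Fin d) (Fin d) ℂ).map (starRingEnd ℂ)) p q ∂μ)
        = mesProj (Fin d) p q := by
  refine ⟨?_, ?_⟩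
  · ext v
    simp only [Set.mem_setOf_eq, SetLike.mem_coe, Submodule.mem_span_singleton]
    refine ⟨fixed_mem_span hd v, ?_⟩
    rintro ⟨c, rfl⟩ U hU
    rw [Matrix.mulVec_smul, mesVec_fixed U hU]
  · intro p q
    let M : Fin d × Fin d → ℂ := fun p => ∫ U : Matrix.unitaryGroup (Fin d) ℂ,
          ((U : Matrix (Fin d) (Fin d) ℂ) ⊗ₖ
            (U : Matrix (Fin d) (Fin d) ℂ).map (starRingEnd ℂ)) p q ∂μ
    have hM : ∀ W ∈ Matrix.unitaryGroup (Fin d) ℂ,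
        (W ⊗ₖ W.map (starRingEnd ℂ)).mulVec M = M := by
      intro W hW
      funext r
      have h1 := integral_mul_left_eq_self (μ := μ)
        (fun U : Matrix.unitaryGroup (Fin d) ℂ =>
          ((U : Matrix (Fin d) (Fin d) ℂ) ⊗ₖ
            (U : Matrix (Fin d) (Fin d) ℂ).map (starRingEnd ℂ)) r q) ⟨W, hW⟩
      refine Eq.trans ?_ h1
      simp only [Submonoid.coe_mul, kron_conj_mul]
      simp only [Matrix.mul_apply (M := W ⊗ₖ W.map (starRingEnd ℂ))]
      rw [integral_finset_sum _ (fun s _ => (entry_integrable μ s q).const_mul _)]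
      simp only [Matrix.mulVec, dotProduct, M, integral_const_mul]
    obtain ⟨c, hc⟩ := fixed_mem_span hd M hM
    have hsum : ∑ r, star (mesVec (Fin d) r) * M r = star (mesVec (Fin d) q) := by
      simp only [M, ← integral_const_mul]
      rw [← integral_finset_sum _ (fun s _ => (entry_integrable μ s q).const_mul _)]
      simp only [fun U : Matrix.unitaryGroup (Fin d) ℂ => mesVec_left_fixed U.1 U.2 q]
      simp
    have hc' : c = star (mesVec (Fin d) q) := by
      rw [← hsum, ← hc]
      simp only [Pi.smul_apply, smul_eq_mul, mul_left_comm _ c]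
      rw [← Finset.mul_sum, mesVec_norm hd, mul_one]
    change M p = _
    rw [← hc, hc']
    simp [mesProj, Matrix.vecMulVec_apply, mul_comm]
end

section
/- Let D ≥ 2 and define the twirling channel T on matrices of ℂ^D ⊗ ℂ^D by T(M) := ∫ (U ⊗ Ū) M (U ⊗ Ū)† dμ(U), the integral over U(D) with Haar probability measure μ. Then for every matrix M on ℂ^D ⊗ ℂ^D, T(M) = Tr[Φ⁺ M] Φ⁺ + Tr[(I − Φ⁺) M] π⁻, where π⁻ := (I − Φ⁺)/(D² − 1). -/
open Matrix MeasureTheory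
open scoped Kronecker

/-- The state `π⁻ = (I − Φ⁺)/(D² − 1)`. -/
noncomputable def mesOrth (ι : Type*) [Fintype ι] [DecidableEq ι] :
    Matrix (ι × ι) (ι × ι) ℂ :=
  (((Fintype.card ι : ℂ) ^ 2 - 1))⁻¹ • ((1 : Matrix (ι × ι) (ι × ι) ℂ) - mesProj ι)

section TwirlHelpers

/-- The matrix `U ⊗ Ū`. -/
noncomputable def twW {D : ℕ} (U : Matrix (Fin D) (Fin D) ℂ) :
    Matrix (Fin D × Fin D) (Fin D × Fin D) ℂ :=
  U ⊗ₖ U.map (starRingEnd ℂ)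

lemma twW_apply {D : ℕ} (U : Matrix (Fin D) (Fin D) ℂ) (a b c d : Fin D) :
    twW U (a, b) (c, d) = U a c * (starRingEnd ℂ) (U b d) := rfl

lemma twW_mul {D : ℕ} (U V : Matrix (Fin D) (Fin D) ℂ) : twW (U * V) = twW U * twW V := by
  unfold twW
  rw [Matrix.map_mul, Matrix.mul_kronecker_mul]

lemma twW_one {D : ℕ} : twW (1 : Matrix (Fin D) (Fin D) ℂ) = 1 := by
  unfold twW
  rw [Matrix.map_one _ (map_zero _) (map_one _), Matrix.one_kronecker_one]

lemma twW_conjTranspose {D : ℕ} (U : Matrix (Fin D) (Fin D) ℂ) : (twW U)ᴴ = twW Uᴴ := by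
  ext ⟨a, b⟩ ⟨c, d⟩
  simp [twW_apply, Matrix.conjTranspose_apply]

lemma twW_mul_star {D : ℕ} (U : Matrix.unitaryGroup (Fin D) ℂ) :
    twW (U : Matrix (Fin D) (Fin D) ℂ) * (twW (U : Matrix (Fin D) (Fin D) ℂ))ᴴ = 1 := by
  rw [twW_conjTranspose, ← twW_mul, ← Matrix.star_eq_conjTranspose,
    Matrix.mem_unitaryGroup_iff.1 U.2, twW_one]

lemma twW_star_mul {D : ℕ} (U : Matrix.unitaryGroup (Fin D) ℂ) :
    (twW (U : Matrix (Fin D) (Fin D) ℂ))ᴴ * twW (U : Matrix (Fin D) (Fin D) ℂ) = 1 := by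
  rw [twW_conjTranspose, ← twW_mul, ← Matrix.star_eq_conjTranspose,
    Matrix.mem_unitaryGroup_iff'.1 U.2, twW_one]

lemma twW_mem {D : ℕ} (U : Matrix.unitaryGroup (Fin D) ℂ) :
    twW (U : Matrix (Fin D) (Fin D) ℂ) ∈ Matrix.unitaryGroup (Fin D × Fin D) ℂ :=
  Matrix.mem_unitaryGroup_iff.2 (twW_mul_star U)

lemma mesProj_apply {D : ℕ} (a b c d : Fin D) :
    mesProj (Fin D) (a, b) (c, d) = if a = b ∧ c = d then (D : ℂ)⁻¹ else 0 := by
  have h : ((Real.sqrt D : ℝ) : ℂ)⁻¹ * ((Real.sqrt D : ℝ) : ℂ)⁻¹ = (D : ℂ)⁻¹ := by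
    rw [← mul_inv, ← Complex.ofReal_mul, Real.mul_self_sqrt (Nat.cast_nonneg D),
      Complex.ofReal_natCast]
  by_cases h1 : a = b <;> by_cases h2 : c = d <;>
    simp [mesProj, Matrix.vecMulVec_apply, mesVec, h1, h2, h]

lemma mesProj_eq {D : ℕ} (p q : Fin D × Fin D) :
    mesProj (Fin D) p q = if p.1 = p.2 ∧ q.1 = q.2 then (D : ℂ)⁻¹ else 0 :=
  mesProj_apply p.1 p.2 q.1 q.2

lemma twW_mul_mesProj {D : ℕ} (U : Matrix.unitaryGroup (Fin D) ℂ) :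
    twW (U : Matrix (Fin D) (Fin D) ℂ) * mesProj (Fin D) = mesProj (Fin D) := by
  ext ⟨a, b⟩ ⟨c, d⟩
  have h := congrFun (congrFun (Matrix.mem_unitaryGroup_iff.1 U.2) a) b
  rw [Matrix.star_eq_conjTranspose, Matrix.mul_apply, Matrix.one_apply] at h
  simp only [Matrix.conjTranspose_apply] at h
  rw [Matrix.mul_apply, Fintype.sum_prod_type]
  simp only [mesProj_apply, twW_apply]
  by_cases hcd : c = d
  · simp only [hcd, and_true, mul_ite, mul_zero, Finset.sum_ite_eq, Finset.mem_univ, if_true]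
    rw [← Finset.sum_mul]
    have h' : ∑ i, (U : Matrix (Fin D) (Fin D) ℂ) a i *
        (starRingEnd ℂ) ((U : Matrix (Fin D) (Fin D) ℂ) b i) = if a = b then 1 else 0 := h
    rw [h']
    split_ifs <;> simp
  · simp [hcd]

lemma mesProj_conjTranspose {D : ℕ} : (mesProj (Fin D))ᴴ = mesProj (Fin D) := by
  ext ⟨a, b⟩ ⟨c, d⟩
  rw [Matrix.conjTranspose_apply, mesProj_apply, mesProj_apply]
  by_cases h1 : a = b <;> by_cases h2 : c = d <;> simp [h1, h2]

lemma mesProj_mul_twW {D : ℕ} (U : Matrix.unitaryGroup (Fin D) ℂ) :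
    mesProj (Fin D) * twW (U : Matrix (Fin D) (Fin D) ℂ) = mesProj (Fin D) := by
  have h := congrArg Matrix.conjTranspose (twW_mul_mesProj U)
  rw [Matrix.conjTranspose_mul, mesProj_conjTranspose] at h
  calc mesProj (Fin D) * twW (U : Matrix (Fin D) (Fin D) ℂ)
      = mesProj (Fin D) * ((twW (U : Matrix (Fin D) (Fin D) ℂ))ᴴ
          * twW (U : Matrix (Fin D) (Fin D) ℂ)) := by rw [← Matrix.mul_assoc, h]
    _ = _ := by rw [twW_star_mul, Matrix.mul_one]

lemma mesProj_trace {D : ℕ} (hD : 2 ≤ D) : (mesProj (Fin D)).trace = 1 := by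
  have : (D : ℂ) ≠ 0 := by exact_mod_cast (by omega : D ≠ 0)
  simp [Matrix.trace, Fintype.sum_prod_type, mesProj_apply, this]

lemma mesProj_sq {D : ℕ} (hD : 2 ≤ D) : mesProj (Fin D) * mesProj (Fin D) = mesProj (Fin D) := by
  have : (D : ℂ) ≠ 0 := by exact_mod_cast (by omega : D ≠ 0)
  ext ⟨a, b⟩ ⟨c, d⟩
  rw [Matrix.mul_apply, Fintype.sum_prod_type]
  simp only [mesProj_apply]
  by_cases h1 : a = b <;> by_cases h2 : c = d <;> simp [h1, h2, this]

/-- Commutation with diagonal unitaries makes `X` sparse. -/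
lemma tw_sparse {D : ℕ} (X : Matrix (Fin D × Fin D) (Fin D × Fin D) ℂ)
    (hX : ∀ U : Matrix.unitaryGroup (Fin D) ℂ,
      twW (U : Matrix (Fin D) (Fin D) ℂ) * X = X * twW (U : Matrix (Fin D) (Fin D) ℂ))
    (a b c d : Fin D) (h1 : ¬ (a = b ∧ c = d)) (h2 : ¬ (a = c ∧ b = d)) :
    X (a, b) (c, d) = 0 := by
  have key : ∀ j : Fin D,
      let v : Fin D → ℂ := fun k => if k = j then Complex.I else 1
      v a * (starRingEnd ℂ) (v b) * X (a, b) (c, d)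
        = X (a, b) (c, d) * (v c * (starRingEnd ℂ) (v d)) := by
    intro j v
    have hv : ∀ k, v k * (starRingEnd ℂ) (v k) = 1 := by
      intro k
      by_cases hk : k = j <;> simp [v, hk]
    have hU : Matrix.diagonal v ∈ Matrix.unitaryGroup (Fin D) ℂ := by
      rw [Matrix.mem_unitaryGroup_iff, Matrix.star_eq_conjTranspose,
        Matrix.diagonal_conjTranspose, Matrix.diagonal_mul_diagonal, ← Matrix.diagonal_one]
      congr 1
      ext k
      exact hv k
    have hW : twW (Matrix.diagonal v)
        = Matrix.diagonal (fun p : Fin D × Fin D => v p.1 * (starRingEnd ℂ) (v p.2)) := by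
      ext ⟨a, b⟩ ⟨c, d⟩
      rw [twW_apply]
      by_cases h1 : a = c <;> by_cases h2 : b = d <;> simp [h1, h2, Matrix.diagonal_apply]
    have h := congrFun (congrFun (hX ⟨_, hU⟩) (a, b)) (c, d)
    simp only [hW, Matrix.diagonal_mul, Matrix.mul_diagonal] at h
    exact h
  have hI1 : Complex.I ≠ 1 := by intro h; simpa using congrArg Complex.im h
  have hI2 : -Complex.I ≠ 1 := by intro h; simpa using congrArg Complex.im h
  have hI3 : Complex.I ≠ -Complex.I := by
    intro h
    have := congrArg Complex.im h
    norm_num at this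
  have fin : ∀ x y z : ℂ, x * z = z * y → x ≠ y → z = 0 := by
    intro x y z h hne
    by_contra hz
    exact hne (mul_left_cancel₀ hz (by rw [← h, mul_comm]))
  by_cases hab : a = b
  · subst hab
    have hcd : c ≠ d := fun h => h1 ⟨rfl, h⟩
    refine fin _ _ _ (key c) ?_
    by_cases hac : a = c <;> simp [hac, hcd.symm, hI1.symm]
  · by_cases hac : a = c
    · subst hac
      have hbd : b ≠ d := fun h => h2 ⟨rfl, h⟩
      refine fin _ _ _ (key b) ?_
      simp [hab, hbd.symm, hI2]
    · refine fin _ _ _ (key a) ?_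
      by_cases had : d = a
      · simp [had, Ne.symm hab, Ne.symm hac, hI3]
      · simp [had, Ne.symm hab, Ne.symm hac, hI1]

/-- Commutation with permutations. -/
lemma tw_perm {D : ℕ} (X : Matrix (Fin D × Fin D) (Fin D × Fin D) ℂ)
    (hX : ∀ U : Matrix.unitaryGroup (Fin D) ℂ,
      twW (U : Matrix (Fin D) (Fin D) ℂ) * X = X * twW (U : Matrix (Fin D) (Fin D) ℂ))
    (σ : Equiv.Perm (Fin D)) (a b c d : Fin D) :
    X (σ a, σ b) (σ c, σ d) = X (a, b) (c, d) := by
  let P : Matrix (Fin D) (Fin D) ℂ := Matrix.of fun i j => if σ i = j then 1 else 0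
  have hP : P ∈ Matrix.unitaryGroup (Fin D) ℂ := by
    rw [Matrix.mem_unitaryGroup_iff, Matrix.star_eq_conjTranspose]
    ext i j
    simp [P, Matrix.mul_apply, Matrix.one_apply, apply_ite, eq_comm]
  have h := congrFun (congrFun (hX ⟨P, hP⟩) (a, b)) (σ c, σ d)
  simp only [Matrix.mul_apply, Fintype.sum_prod_type, twW_apply, P, Matrix.of_apply] at h
  simpa [apply_ite, ite_and, Finset.sum_ite_irrel] using h

lemma exists_perm_pair {D : ℕ} (a c a' c' : Fin D) (h : a ≠ c) (h' : a' ≠ c') :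
    ∃ σ : Equiv.Perm (Fin D), σ a = a' ∧ σ c = c' := by
  refine ⟨(Equiv.swap a a').trans (Equiv.swap (Equiv.swap a a' c) c'), ?_, ?_⟩
  · rw [Equiv.trans_apply, Equiv.swap_apply_left]
    apply Equiv.swap_apply_of_ne_of_ne _ h'
    intro hh
    apply h
    apply (Equiv.swap a a').injective
    rw [← hh, Equiv.swap_apply_left]
  · rw [Equiv.trans_apply, Equiv.swap_apply_left]

/-- The commutant of `U ⊗ Ū` is spanned by `1` and `Φ⁺`. -/
lemma tw_commutant {D : ℕ} (hD : 2 ≤ D) (X : Matrix (Fin D × Fin D) (Fin D × Fin D) ℂ)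
    (hX : ∀ U : Matrix.unitaryGroup (Fin D) ℂ,
      twW (U : Matrix (Fin D) (Fin D) ℂ) * X = X * twW (U : Matrix (Fin D) (Fin D) ℂ)) :
    ∃ β κ : ℂ, X = β • (1 : Matrix (Fin D × Fin D) (Fin D × Fin D) ℂ) + κ • mesProj (Fin D) := by
  have hDC : (D : ℂ) ≠ 0 := by exact_mod_cast (by omega : D ≠ 0)
  let i : Fin D := ⟨0, by omega⟩
  let j : Fin D := ⟨1, by omega⟩
  have hij : i ≠ j := by simp [i, j]
  let α := X (i, i) (j, j)
  let β := X (i, j) (i, j)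
  let δ := X (i, i) (i, i) - α - β
  let E : Matrix (Fin D × Fin D) (Fin D × Fin D) ℂ :=
    Matrix.of fun p q => if p = q ∧ p.1 = p.2 then 1 else 0
  have hform : X = β • (1 : Matrix (Fin D × Fin D) (Fin D × Fin D) ℂ)
      + (α * D) • mesProj (Fin D) + δ • E := by
    ext ⟨a, b⟩ ⟨c, d⟩
    simp only [Matrix.add_apply, Matrix.smul_apply, smul_eq_mul, Matrix.one_apply,
      mesProj_apply, E, Matrix.of_apply, Prod.mk.injEq]
    by_cases h1 : a = b ∧ c = d
    · obtain ⟨rfl, rfl⟩ := h1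
      by_cases hac : a = c
      · subst hac
        have : X (a, a) (a, a) = X (i, i) (i, i) := by
          have := tw_perm X hX (Equiv.swap i a) i i i i
          rwa [Equiv.swap_apply_left] at this
        simp [this, δ, hDC]
        ring
      · obtain ⟨σ, h1, h2⟩ := exists_perm_pair i j a c hij hac
        have := tw_perm X hX σ i i j j
        rw [h1, h2] at this
        simp [this, α, hac, hDC]
    · by_cases h2 : a = c ∧ b = d
      · obtain ⟨rfl, rfl⟩ := h2
        have hab : a ≠ b := fun h => h1 ⟨h, h⟩
        obtain ⟨σ, h1, h2⟩ := exists_perm_pair i j a b hij hab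
        have := tw_perm X hX σ i j i j
        rw [h1, h2] at this
        simp [this, β, hab]
      · rw [tw_sparse X hX a b c d h1 h2]
        have h3 : ¬ ((a = c ∧ b = d) ∧ a = b) := fun h => h2 h.1
        rw [if_neg h1, if_neg h2, if_neg h3]
        ring
  have hE : ∀ U : Matrix.unitaryGroup (Fin D) ℂ,
      twW (U : Matrix (Fin D) (Fin D) ℂ) * (δ • E)
        = (δ • E) * twW (U : Matrix (Fin D) (Fin D) ℂ) := by
    intro U
    have h := hX U
    rw [hform] at h
    simp only [Matrix.mul_add, Matrix.add_mul, Matrix.mul_smul, Matrix.smul_mul,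
      Matrix.mul_one, Matrix.one_mul, twW_mul_mesProj, mesProj_mul_twW] at h
    rw [Matrix.mul_smul, Matrix.smul_mul]
    exact add_left_cancel h
  let z : ℂ := (1 - Complex.I) / D
  have hI1 : (1 : ℂ) - Complex.I ≠ 0 := by
    intro h
    simpa using congrArg Complex.im h
  have hz : z ≠ 0 := div_ne_zero hI1 hDC
  have hz1 : 1 - z ≠ 0 := by
    intro h
    have h2 : (D : ℂ) = 1 - Complex.I := by
      have : z = 1 := (sub_eq_zero.1 h).symm
      rw [div_eq_one_iff_eq hDC] at this
      exact this.symm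
    simpa using congrArg Complex.im h2
  let V : Matrix (Fin D) (Fin D) ℂ := 1 - z • Matrix.of fun _ _ => 1
  have hV : V ∈ Matrix.unitaryGroup (Fin D) ℂ := by
    rw [Matrix.mem_unitaryGroup_iff, Matrix.star_eq_conjTranspose]
    have hJ : (Matrix.of fun _ _ => 1 : Matrix (Fin D) (Fin D) ℂ) * (Matrix.of fun _ _ => 1)
        = (D : ℂ) • Matrix.of fun _ _ => 1 := by
      ext a b
      simp [Matrix.mul_apply]
    have hJs : (Matrix.of fun _ _ => 1 : Matrix (Fin D) (Fin D) ℂ)ᴴ = Matrix.of fun _ _ => 1 := by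
      ext a b
      simp
    have hzz : z + star z = z * star z * D := by
      have : star z = (1 + Complex.I) / D := by simp [z]
      rw [this]
      simp only [z]
      field_simp
      ring_nf
      simp
      try norm_num
    simp only [V, Matrix.conjTranspose_sub, Matrix.conjTranspose_one, Matrix.conjTranspose_smul,
      hJs, Matrix.mul_sub, Matrix.sub_mul, Matrix.mul_one, Matrix.one_mul, Matrix.mul_smul,
      Matrix.smul_mul, hJ]
    ext a b
    simp only [Matrix.sub_apply, Matrix.smul_apply, Matrix.of_apply, smul_eq_mul]
    linear_combination (-1 : ℂ) * hzz
  have hδ : δ = 0 := by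
    have h := congrFun (congrFun (hE ⟨V, hV⟩) (i, j)) (i, i)
    have e1 : (twW V * (δ • E)) (i, j) (i, i) = δ * (V i i * (starRingEnd ℂ) (V j i)) := by
      rw [Matrix.mul_apply, Finset.sum_eq_single (i, i)]
      · simp [twW_apply, E]; ring
      · intro p _ hp
        simp [E, hp]
      · simp
    have e2 : ((δ • E) * twW V) (i, j) (i, i) = 0 := by
      rw [Matrix.mul_apply]
      apply Finset.sum_eq_zero
      intro p _
      simp [E, hij]
    rw [e1, e2] at h
    have hVii : V i i = 1 - z := by simp [V]
    have hVji : V j i = -z := by simp [V, Matrix.one_apply, hij.symm]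
    rw [hVii, hVji] at h
    rcases mul_eq_zero.1 h with h | h
    · exact h
    · rcases mul_eq_zero.1 h with h | h
      · exact absurd h hz1
      · exact absurd h (by simpa using hz)
  refine ⟨β, α * D, ?_⟩
  conv_lhs => rw [hform]
  rw [hδ, zero_smul, add_zero]

/-- The integrand. -/
noncomputable def twF {D : ℕ} (M : Matrix (Fin D × Fin D) (Fin D × Fin D) ℂ)
    (U : Matrix.unitaryGroup (Fin D) ℂ) : Matrix (Fin D × Fin D) (Fin D × Fin D) ℂ :=
  twW (U : Matrix (Fin D) (Fin D) ℂ) * M * (twW (U : Matrix (Fin D) (Fin D) ℂ))ᴴ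

lemma twF_integrable {D : ℕ} 
    [MeasurableSpace (Matrix.unitaryGroup (Fin D) ℂ)]
    [BorelSpace (Matrix.unitaryGroup (Fin D) ℂ)]
    (μ : Measure (Matrix.unitaryGroup (Fin D) ℂ)) [IsProbabilityMeasure μ]
    (M : Matrix (Fin D × Fin D) (Fin D × Fin D) ℂ) (p q : Fin D × Fin D) :
    Integrable (fun U => twF M U p q) μ := by
  have hentry : ∀ a b : Fin D,
      Continuous fun U : Matrix.unitaryGroup (Fin D) ℂ => (U : Matrix (Fin D) (Fin D) ℂ) a b :=
    fun a b => (continuous_subtype_val).matrix_elem a b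
  have hW : ∀ p q : Fin D × Fin D, Continuous fun U : Matrix.unitaryGroup (Fin D) ℂ =>
      twW (U : Matrix (Fin D) (Fin D) ℂ) p q :=
    fun p q => (hentry _ _).mul (Complex.continuous_conj.comp (hentry _ _))
  have hexp : ∀ U, twF M U p q = ∑ s, (∑ r, twW (U : Matrix (Fin D) (Fin D) ℂ) p r * M r s) *
      star (twW (U : Matrix (Fin D) (Fin D) ℂ) q s) := by
    intro U
    simp only [twF, Matrix.mul_apply, Matrix.conjTranspose_apply]
  refine Integrable.of_bound (C := ∑ s, ∑ r, ‖M r s‖) ?_ (Filter.Eventually.of_forall ?_)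
  · apply Continuous.aestronglyMeasurable
    simp only [hexp]
    refine continuous_finsetSum _ fun s _ => Continuous.mul ?_ (hW q s).star
    exact continuous_finsetSum _ fun r _ => (hW p r).mul continuous_const
  · intro U
    rw [hexp]
    refine (norm_sum_le _ _).trans (Finset.sum_le_sum fun s _ => ?_)
    have hb := fun p q => entry_norm_bound_of_unitary (twW_mem U) p q
    rw [norm_mul, norm_star]
    refine (mul_le_of_le_one_right (norm_nonneg _) (hb q s)).trans ?_
    refine (norm_sum_le _ _).trans (Finset.sum_le_sum fun r _ => ?_)
    rw [norm_mul]
    exact mul_le_of_le_one_left (norm_nonneg _) (hb p r)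

lemma tw_integral_mul {D : ℕ} 
    [MeasurableSpace (Matrix.unitaryGroup (Fin D) ℂ)]
    [BorelSpace (Matrix.unitaryGroup (Fin D) ℂ)]
    (μ : Measure (Matrix.unitaryGroup (Fin D) ℂ)) [IsProbabilityMeasure μ]
    (M A B : Matrix (Fin D × Fin D) (Fin D × Fin D) ℂ) (p q : Fin D × Fin D) :
    (A * (Matrix.of fun p q => ∫ U, twF M U p q ∂μ) * B) p q
      = ∫ U, (A * twF M U * B) p q ∂μ := by
  simp only [Matrix.mul_apply, Matrix.of_apply]
  have hi := twF_integrable μ M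
  rw [integral_finsetSum]
  · refine Finset.sum_congr rfl fun s _ => ?_
    rw [integral_mul_const, integral_finsetSum]
    · simp only [integral_const_mul]
    · exact fun r _ => (hi r s).const_mul _
  · intro s _
    exact (integrable_finsetSum _ fun r _ => (hi r s).const_mul _).mul_const _

lemma tw_integral_trace {D : ℕ} 
    [MeasurableSpace (Matrix.unitaryGroup (Fin D) ℂ)]
    [BorelSpace (Matrix.unitaryGroup (Fin D) ℂ)]
    (μ : Measure (Matrix.unitaryGroup (Fin D) ℂ)) [IsProbabilityMeasure μ]
    (M A : Matrix (Fin D × Fin D) (Fin D × Fin D) ℂ)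
    (hA : ∀ U : Matrix.unitaryGroup (Fin D) ℂ,
      A * twW (U : Matrix (Fin D) (Fin D) ℂ) = twW (U : Matrix (Fin D) (Fin D) ℂ) * A) :
    (A * (Matrix.of fun p q => ∫ U, twF M U p q ∂μ)).trace = (A * M).trace := by
  have h1 : ∀ U, (A * twF M U).trace = (A * M).trace := by
    intro U
    unfold twF
    rw [← Matrix.mul_assoc, ← Matrix.mul_assoc, hA, Matrix.trace_mul_comm, Matrix.mul_assoc,
      ← Matrix.mul_assoc, twW_star_mul, Matrix.one_mul]
  have hi := twF_integrable μ M
  calc (A * (Matrix.of fun p q => ∫ U, twF M U p q ∂μ)).trace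
      = ∑ p, ∫ U, (A * twF M U * (1 : Matrix (Fin D × Fin D) (Fin D × Fin D) ℂ)) p p ∂μ := by
        rw [Matrix.trace]
        refine Finset.sum_congr rfl fun p _ => ?_
        rw [← tw_integral_mul, Matrix.mul_one, Matrix.diag_apply]
    _ = ∫ U, ∑ p, (A * twF M U * (1 : Matrix (Fin D × Fin D) (Fin D × Fin D) ℂ)) p p ∂μ := by
        rw [integral_finsetSum]
        intro p _
        simp only [Matrix.mul_one]
        simp only [Matrix.mul_apply]
        exact integrable_finsetSum _ fun r _ => (hi r p).const_mul _
    _ = ∫ U, (A * M).trace ∂μ := by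
        refine integral_congr_ae (Filter.Eventually.of_forall fun U => ?_)
        simp only [Matrix.mul_one]
        rw [← h1 U, Matrix.trace]
        simp only [Matrix.diag_apply]
    _ = _ := by simp

end TwirlHelpers

/-- For `D ≥ 2` and any matrix `M` on `ℂ^D ⊗ ℂ^D`, the twirling
channel `T(M) = ∫ (U ⊗ Ū) M (U ⊗ Ū)† dμ(U)` satisfies
`T(M) = Tr[Φ⁺M] Φ⁺ + Tr[(I − Φ⁺)M] π⁻` with `π⁻ = (I − Φ⁺)/(D² − 1)`. -/
theorem twirling_channel_formula (D : ℕ) (hD : 2 ≤ D)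
    [MeasurableSpace (Matrix.unitaryGroup (Fin D) ℂ)]
    [BorelSpace (Matrix.unitaryGroup (Fin D) ℂ)]
    (μ : Measure (Matrix.unitaryGroup (Fin D) ℂ))
    [μ.IsHaarMeasure] [IsProbabilityMeasure μ]
    (M : Matrix (Fin D × Fin D) (Fin D × Fin D) ℂ) :
    ∀ p q : Fin D × Fin D,
      (∫ U : Matrix.unitaryGroup (Fin D) ℂ,
          (((U : Matrix (Fin D) (Fin D) ℂ) ⊗ₖ
              (U : Matrix (Fin D) (Fin D) ℂ).map (starRingEnd ℂ)) * M *
            ((U : Matrix (Fin D) (Fin D) ℂ) ⊗ₖ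
              (U : Matrix (Fin D) (Fin D) ℂ).map (starRingEnd ℂ))ᴴ) p q ∂μ)
        = (Matrix.trace (mesProj (Fin D) * M) • mesProj (Fin D) +
            Matrix.trace (((1 : Matrix (Fin D × Fin D) (Fin D × Fin D) ℂ) -
              mesProj (Fin D)) * M) • mesOrth (Fin D)) p q := by
  intro p q
  have hDC : (D : ℂ) ≠ 0 := by exact_mod_cast (by omega : D ≠ 0)
  have hD1 : (D : ℂ) ^ 2 - 1 ≠ 0 := by
    intro h
    have h2 : (D : ℂ) ^ 2 = 1 := sub_eq_zero.1 h
    have h3 : D ^ 2 = 1 := by exact_mod_cast h2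
    nlinarith
  set X : Matrix (Fin D × Fin D) (Fin D × Fin D) ℂ :=
    Matrix.of fun p q => ∫ U, twF M U p q ∂μ with hXdef
  change X p q = _
  have hinv : ∀ V : Matrix.unitaryGroup (Fin D) ℂ,
      twW (V : Matrix (Fin D) (Fin D) ℂ) * X * (twW (V : Matrix (Fin D) (Fin D) ℂ))ᴴ = X := by
    intro V
    ext a b
    rw [hXdef, tw_integral_mul]
    have h1 : ∀ U, twW (V : Matrix (Fin D) (Fin D) ℂ) * twF M U *
        (twW (V : Matrix (Fin D) (Fin D) ℂ))ᴴ = twF M (V * U) := by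
      intro U
      unfold twF
      rw [Submonoid.coe_mul, twW_mul, Matrix.conjTranspose_mul]
      simp only [Matrix.mul_assoc]
    simp only [h1]
    exact integral_mul_left_eq_self (fun U => twF M U a b) V
  have hcomm : ∀ V : Matrix.unitaryGroup (Fin D) ℂ,
      twW (V : Matrix (Fin D) (Fin D) ℂ) * X = X * twW (V : Matrix (Fin D) (Fin D) ℂ) := by
    intro V
    conv_rhs => rw [← hinv V]
    rw [Matrix.mul_assoc, twW_star_mul, Matrix.mul_one]
  obtain ⟨β, κ, hform⟩ := tw_commutant hD X hcomm
  have ht1 := tw_integral_trace μ M 1 (fun U => by rw [Matrix.one_mul, Matrix.mul_one])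
  have ht2 := tw_integral_trace μ M (mesProj (Fin D))
    (fun U => by rw [mesProj_mul_twW, twW_mul_mesProj])
  rw [← hXdef, hform] at ht1 ht2
  simp only [Matrix.one_mul, Matrix.mul_add, Matrix.mul_smul, Matrix.mul_one, mesProj_sq hD,
    Matrix.trace_add, Matrix.trace_smul, mesProj_trace hD, Matrix.trace_one, smul_eq_mul,
    Fintype.card_prod, Fintype.card_fin, Nat.cast_mul] at ht1 ht2
  rw [hform, Matrix.sub_mul, Matrix.one_mul, Matrix.trace_sub, ← ht1, ← ht2]
  simp only [mesOrth, Matrix.add_apply, Matrix.smul_apply, Matrix.sub_apply, smul_eq_mul,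
    Fintype.card_fin]
  field_simp
  ring
end

section
/- Let D ≥ 2 and label four copies of ℂ^D as systems 1, 2, 3, 4. Let T_{14} denote the twirling channel M ↦ ∫ (U ⊗ Ū) M (U ⊗ Ū)† dμ(U) applied to systems 1 and 4 (tensored with the identity on systems 2 and 3). Then (T_{14} ⊗ id_{23}) (Φ⁺_{12} ⊗ Φ⁺_{34}) = (1/D²) Φ⁺_{14} ⊗ Φ⁺_{23} + ((D² − 1)/D²) π⁻_{14} ⊗ π⁻_{23}, where subscripts indicate on which pair of systems each operator acts (with appropriate reordering of tensor factors). -/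
open Matrix MeasureTheory
open scoped Kronecker

/-- Four copies of `ℂ^D`, labelled systems 1, 2, 3, 4. An index `p` stands for
`(p.1, p.2.1, p.2.2.1, p.2.2.2)` on systems `(1,2,3,4)`. -/
abbrev I4 (D : ℕ) := Fin D × Fin D × Fin D × Fin D

/-- The unitary `U ⊗ Ū` acting on systems 1 and 4, tensored with the identity on
systems 2 and 3. -/
noncomputable def uOn14 (D : ℕ) (U : Matrix (Fin D) (Fin D) ℂ) :
    Matrix (I4 D) (I4 D) ℂ :=
  Matrix.of fun p q =>
    U p.1 q.1 * (if p.2.1 = q.2.1 then 1 else 0) * (if p.2.2.1 = q.2.2.1 then 1 else 0) *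
      (starRingEnd ℂ) (U p.2.2.2 q.2.2.2)

/-- The state `Φ⁺_{12} ⊗ Φ⁺_{34}` (with the obvious reordering of tensor factors). -/
noncomputable def mes12mes34 (D : ℕ) : Matrix (I4 D) (I4 D) ℂ :=
  Matrix.of fun p q =>
    mesProj (Fin D) (p.1, p.2.1) (q.1, q.2.1) *
      mesProj (Fin D) (p.2.2.1, p.2.2.2) (q.2.2.1, q.2.2.2)

section TwirlAux

set_option linter.unusedSectionVars false

variable {D : ℕ} [MeasurableSpace (Matrix.unitaryGroup (Fin D) ℂ)]

/-- Second moments of the matrix entries of a random unitary. -/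
noncomputable def twMom (μ : Measure (Matrix.unitaryGroup (Fin D) ℂ)) (j l n s i k m r : Fin D) : ℂ :=
  ∫ U : Matrix.unitaryGroup (Fin D) ℂ, (U : Matrix (Fin D) (Fin D) ℂ) i j *
    (U : Matrix (Fin D) (Fin D) ℂ) k l * star ((U : Matrix (Fin D) (Fin D) ℂ) m n) *
    star ((U : Matrix (Fin D) (Fin D) ℂ) r s) ∂μ

variable [BorelSpace (Matrix.unitaryGroup (Fin D) ℂ)]
    (μ : Measure (Matrix.unitaryGroup (Fin D) ℂ))
    [μ.IsHaarMeasure] [IsProbabilityMeasure μ]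

theorem twMom_integrable (j l n s i k m r : Fin D) :
    Integrable (fun U : Matrix.unitaryGroup (Fin D) ℂ => (U : Matrix (Fin D) (Fin D) ℂ) i j *
    (U : Matrix (Fin D) (Fin D) ℂ) k l * star ((U : Matrix (Fin D) (Fin D) ℂ) m n) *
    star ((U : Matrix (Fin D) (Fin D) ℂ) r s)) μ := by
  have hc : ∀ a b : Fin D, Continuous (fun U : Matrix.unitaryGroup (Fin D) ℂ =>
      (U : Matrix (Fin D) (Fin D) ℂ) a b) := fun a b =>
    (continuous_subtype_val).matrix_elem a b
  refine Integrable.of_bound (C := 1) ?_ ?_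
  · exact ((((hc i j).mul (hc k l)).mul (hc m n).star).mul (hc r s).star).aestronglyMeasurable
  · refine Filter.Eventually.of_forall fun U => ?_
    have hb : ∀ a b, ‖(U : Matrix (Fin D) (Fin D) ℂ) a b‖ ≤ 1 :=
      fun a b => entry_norm_bound_of_unitary U.2 a b
    simp only [norm_mul, norm_star]
    have h1 := mul_le_one₀ (hb i j) (norm_nonneg _) (hb k l)
    have h2 := mul_le_one₀ h1 (norm_nonneg _) (hb m n)
    exact mul_le_one₀ h2 (norm_nonneg _) (hb r s)

theorem twMom_inv (W : Matrix.unitaryGroup (Fin D) ℂ) (j l n s i k m r : Fin D) :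
    twMom μ j l n s i k m r = ∫ U : Matrix.unitaryGroup (Fin D) ℂ,
      ((W : Matrix (Fin D) (Fin D) ℂ) * (U : Matrix (Fin D) (Fin D) ℂ)) i j *
      ((W : Matrix (Fin D) (Fin D) ℂ) * (U : Matrix (Fin D) (Fin D) ℂ)) k l *
      star (((W : Matrix (Fin D) (Fin D) ℂ) * (U : Matrix (Fin D) (Fin D) ℂ)) m n) *
      star (((W : Matrix (Fin D) (Fin D) ℂ) * (U : Matrix (Fin D) (Fin D) ℂ)) r s) ∂μ := by
  unfold twMom
  rw [← integral_mul_left_eq_self _ W]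
  rfl

theorem twMom_phase (w : Fin D → ℂ) (hw : ∀ x, w x * star (w x) = 1)
    (j l n s i k m r : Fin D) :
    twMom μ j l n s i k m r =
      (w i * w k * star (w m) * star (w r)) * twMom μ j l n s i k m r := by
  have hW : Matrix.diagonal w ∈ Matrix.unitaryGroup (Fin D) ℂ := by
    rw [Matrix.mem_unitaryGroup_iff, star_eq_conjTranspose, diagonal_conjTranspose,
      diagonal_mul_diagonal, ← diagonal_one]
    congr 1
    funext x
    exact hw x
  conv_lhs => rw [twMom_inv μ ⟨_, hW⟩]
  unfold twMom
  rw [← integral_const_mul]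
  congr 1
  funext U
  simp only [diagonal_mul, star_mul']
  ring

theorem twMom_perm (σ : Equiv.Perm (Fin D)) (j l n s i k m r : Fin D) :
    twMom μ j l n s i k m r = twMom μ j l n s (σ i) (σ k) (σ m) (σ r) := by
  have hW : (σ.permMatrix ℂ) ∈ Matrix.unitaryGroup (Fin D) ℂ := by
    rw [Matrix.mem_unitaryGroup_iff, star_eq_conjTranspose]
    ext a b
    simp [Matrix.mul_apply, Equiv.Perm.permMatrix, PEquiv.toMatrix_apply, Matrix.one_apply]
    rw [Finset.sum_eq_single (σ a)]
    · simp
    · intro x _ hx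
      simp [hx.symm]
    · simp
  rw [twMom_inv μ ⟨_, hW⟩]
  unfold twMom
  congr 1
  funext U
  simp [Matrix.mul_apply, Equiv.Perm.permMatrix, PEquiv.toMatrix_apply]

theorem twMom_zero (j l n s i k m r : Fin D)
    (h1 : ¬ (i = m ∧ k = r)) (h2 : ¬ (i = r ∧ k = m)) : twMom μ j l n s i k m r = 0 := by
  by_contra hX
  have key : ∀ x : Fin D, (if i = x then Complex.I else 1) * (if k = x then Complex.I else 1) *
      star (if m = x then Complex.I else 1) * star (if r = x then Complex.I else 1) = 1 := by
    intro x
    have := twMom_phase μ (fun y => if y = x then Complex.I else 1)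
      (by intro y; split_ifs <;> simp) j l n s i k m r
    exact (mul_right_cancel₀ hX (by rw [one_mul]; exact this)).symm
  have ki := key i
  have kk := key k
  have km := key m
  have kr := key r
  clear key hX
  by_cases e1 : i = k <;> by_cases e2 : i = m <;> by_cases e3 : i = r <;>
    by_cases e4 : k = m <;> by_cases e5 : k = r <;> by_cases e6 : m = r <;>
    simp_all [Complex.ext_iff, @eq_comm _ k i, @eq_comm _ m i, @eq_comm _ r i, @eq_comm _ m k,
      @eq_comm _ r k, @eq_comm _ r m]
  all_goals norm_num at ki

theorem twMom_refl (j l n s x y : Fin D) (hxy : x ≠ y) :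
    twMom μ j l n s x x x x = twMom μ j l n s x y x y + twMom μ j l n s x y y x := by
  let u : Fin D → ℂ := fun z => if z = x then 1/5 else if z = y then 7/5 else 0
  have huu : u ⬝ᵥ u = 2 := by
    have : ∀ z, u z * u z = (if z = x then 1/25 else 0) + (if z = y then 49/25 else 0) := by
      intro z
      by_cases h : z = x
      · subst h; simp [u, hxy]; norm_num
      · by_cases h' : z = y
        · subst h'; simp [u, h]; norm_num
        · simp [u, h, h']
    simp only [dotProduct, this, Finset.sum_add_distrib, Finset.sum_ite_eq', Finset.mem_univ,
      if_true]
    norm_num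
  have hsu : star u = u := by
    funext z
    simp only [Pi.star_apply, u]
    split_ifs <;> simp
  have hW : (1 - vecMulVec u u) ∈ Matrix.unitaryGroup (Fin D) ℂ := by
    rw [Matrix.mem_unitaryGroup_iff, star_eq_conjTranspose, conjTranspose_sub,
      conjTranspose_one, conjTranspose_vecMulVec, hsu]
    rw [sub_mul, mul_sub, mul_sub, vecMulVec_mul_vecMulVec, huu]
    rw [vecMulVec_smul, mul_one, one_mul, mul_one, two_smul]
    abel
  have row : ∀ (U : Matrix.unitaryGroup (Fin D) ℂ) (c : Fin D),
      ((1 - vecMulVec u u) * (U : Matrix (Fin D) (Fin D) ℂ)) x c =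
        24/25 * (U : Matrix (Fin D) (Fin D) ℂ) x c -
        7/25 * (U : Matrix (Fin D) (Fin D) ℂ) y c := by
    intro U c
    have : ∀ z, (vecMulVec u u) x z * (U : Matrix (Fin D) (Fin D) ℂ) z c =
        (if z = x then 1/25 * (U : Matrix (Fin D) (Fin D) ℂ) z c else 0) +
        (if z = y then 7/25 * (U : Matrix (Fin D) (Fin D) ℂ) z c else 0) := by
      intro z
      by_cases h : z = x
      · subst h; simp [u, hxy, vecMulVec_apply]; left; norm_num
      · by_cases h' : z = y
        · subst h'; simp [u, h, vecMulVec_apply]; left; norm_num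
        · simp [u, h, h', vecMulVec_apply]
    rw [sub_mul, one_mul, Matrix.sub_apply, Matrix.mul_apply]
    simp only [this, Finset.sum_add_distrib, Finset.sum_ite_eq', Finset.mem_univ, if_true]
    ring
  let v : Bool → Fin D := fun b => if b then x else y
  let cf : Bool → ℂ := fun b => if b then 24/25 else -(7/25)
  have main : twMom μ j l n s x x x x = ∑ e : Bool × Bool × Bool × Bool,
      (cf e.1 * cf e.2.1 * cf e.2.2.1 * cf e.2.2.2) *
        twMom μ j l n s (v e.1) (v e.2.1) (v e.2.2.1) (v e.2.2.2) := by
    rw [twMom_inv μ ⟨_, hW⟩]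
    unfold twMom
    simp only [← integral_const_mul]
    rw [← integral_finsetSum _ (fun e _ => (twMom_integrable μ j l n s _ _ _ _).const_mul _)]
    congr 1
    funext U
    simp only [row, Fintype.sum_prod_type, Fintype.sum_bool, v, cf, if_true, star_sub, star_mul']
    have h24 : star (24/25 : ℂ) = 24/25 := by simp
    have h7 : star (7/25 : ℂ) = 7/25 := by simp
    simp only [h24, h7, Bool.false_eq_true, if_false]
    ring
  have hyx : y ≠ x := hxy.symm
  have s1 := twMom_perm μ (Equiv.swap x y) j l n s x x x x
  have s2 := twMom_perm μ (Equiv.swap x y) j l n s x y x y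
  have s3 := twMom_perm μ (Equiv.swap x y) j l n s x y y x
  simp only [Equiv.swap_apply_left, Equiv.swap_apply_right] at s1 s2 s3
  simp only [Fintype.sum_prod_type, Fintype.sum_bool, v, cf, if_true, Bool.false_eq_true,
    if_false] at main
  rw [← s1, ← s2, ← s3] at main
  rw [twMom_zero μ j l n s x x x y, twMom_zero μ j l n s x x y x, twMom_zero μ j l n s x x y y,
    twMom_zero μ j l n s x y x x, twMom_zero μ j l n s y x x x, twMom_zero μ j l n s y y x x,
    twMom_zero μ j l n s x y y y, twMom_zero μ j l n s y x y y, twMom_zero μ j l n s y y x y,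
    twMom_zero μ j l n s y y y x] at main
  · linear_combination (390625/56448 : ℂ) * main
  all_goals simp [hxy, hyx]

theorem twMom_form (hD : 2 ≤ D) (j l n s : Fin D) : ∃ a b : ℂ, ∀ i k m r : Fin D,
    twMom μ j l n s i k m r = a * (if i = m ∧ k = r then 1 else 0) +
      b * (if i = r ∧ k = m then 1 else 0) := by
  let x : Fin D := ⟨0, by omega⟩
  let y : Fin D := ⟨1, by omega⟩
  have hxy : x ≠ y := by simp [x, y]
  have ab : ∀ i k : Fin D, i ≠ k → twMom μ j l n s i k i k = twMom μ j l n s x y x y ∧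
      twMom μ j l n s i k k i = twMom μ j l n s x y y x := by
    intro i k hik
    obtain ⟨σ, h1, h2⟩ : ∃ σ : Equiv.Perm (Fin D), σ x = i ∧ σ y = k := by
      have hne : Equiv.swap x i y ≠ i := by
        intro h
        have : Equiv.swap x i y = Equiv.swap x i x := by rw [h, Equiv.swap_apply_left]
        exact hxy ((Equiv.swap x i).injective this).symm
      refine ⟨Equiv.swap (Equiv.swap x i y) k * Equiv.swap x i, ?_, ?_⟩
      · rw [Equiv.Perm.mul_apply, Equiv.swap_apply_left,
          Equiv.swap_apply_of_ne_of_ne hne.symm hik]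
      · rw [Equiv.Perm.mul_apply, Equiv.swap_apply_left]
    constructor
    · rw [twMom_perm μ σ j l n s x y x y, h1, h2]
    · rw [twMom_perm μ σ j l n s x y y x, h1, h2]
  refine ⟨twMom μ j l n s x y x y, twMom μ j l n s x y y x, fun i k m r => ?_⟩
  by_cases h1 : i = m ∧ k = r
  · obtain ⟨rfl, rfl⟩ := h1
    by_cases hik : i = k
    · subst hik
      have hx := twMom_perm μ (Equiv.swap x i) j l n s x x x x
      rw [Equiv.swap_apply_left] at hx
      rw [← hx, twMom_refl μ j l n s x y hxy]
      simp
    · rw [(ab i k hik).1]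
      simp [hik]
  · by_cases h2 : i = r ∧ k = m
    · obtain ⟨rfl, rfl⟩ := h2
      have hik : i ≠ k := fun h => h1 ⟨h, h.symm⟩
      rw [(ab i k hik).2]
      simp [hik]
    · rw [twMom_zero μ j l n s i k m r h1 h2, if_neg h1, if_neg h2]
      simp

theorem unit_col (U : Matrix.unitaryGroup (Fin D) ℂ) (a b : Fin D) :
    ∑ i, (U : Matrix (Fin D) (Fin D) ℂ) i a * star ((U : Matrix (Fin D) (Fin D) ℂ) i b) =
      if a = b then 1 else 0 := by
  have h := (Matrix.mem_unitaryGroup_iff'.mp U.2)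
  have h2 := congrFun (congrFun h b) a
  rw [star_eq_conjTranspose, Matrix.mul_apply, Matrix.one_apply] at h2
  simp only [conjTranspose_apply] at h2
  simp only [eq_comm (a := a)]
  rw [← h2]
  exact Finset.sum_congr rfl fun i _ => mul_comm _ _

theorem twMom_eq (hD : 2 ≤ D) (j l n s i k m r : Fin D) :
    twMom μ j l n s i k m r = ((D : ℂ)^2 - 1)⁻¹ * (
      ((if j = n ∧ l = s then 1 else 0) - (D : ℂ)⁻¹ * (if j = s ∧ l = n then 1 else 0)) *
        (if i = m ∧ k = r then 1 else 0) +
      ((if j = s ∧ l = n then 1 else 0) - (D : ℂ)⁻¹ * (if j = n ∧ l = s then 1 else 0)) *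
        (if i = r ∧ k = m then 1 else 0)) := by
  obtain ⟨a, b, hab⟩ := twMom_form μ hD j l n s
  have c1 : ∑ i, ∑ k, twMom μ j l n s i k i k = if j = n ∧ l = s then 1 else 0 := by
    unfold twMom
    simp_rw [← integral_finsetSum _ (fun e _ => (twMom_integrable μ j l n s _ e _ e))]
    rw [← integral_finsetSum _ (fun e _ => integrable_finsetSum _
      (fun f _ => (twMom_integrable μ j l n s e f e f)))]
    have : ∀ U : Matrix.unitaryGroup (Fin D) ℂ, (∑ i, ∑ k, (U : Matrix (Fin D) (Fin D) ℂ) i j *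
        (U : Matrix (Fin D) (Fin D) ℂ) k l * star ((U : Matrix (Fin D) (Fin D) ℂ) i n) *
        star ((U : Matrix (Fin D) (Fin D) ℂ) k s)) = if j = n ∧ l = s then 1 else 0 := by
      intro U
      rw [show (if j = n ∧ l = s then (1:ℂ) else 0) =
        (if j = n then 1 else 0) * (if l = s then 1 else 0) by split_ifs <;> simp_all,
        ← unit_col U j n, ← unit_col U l s, Finset.sum_mul_sum]
      refine Finset.sum_congr rfl fun i _ => Finset.sum_congr rfl fun k _ => by ring
    simp only [this]
    simp
  have c2 : ∑ i, ∑ k, twMom μ j l n s i k k i = if j = s ∧ l = n then 1 else 0 := by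
    unfold twMom
    simp_rw [← integral_finsetSum _ (fun e _ => (twMom_integrable μ j l n s _ e e _))]
    rw [← integral_finsetSum _ (fun e _ => integrable_finsetSum _
      (fun f _ => (twMom_integrable μ j l n s e f f e)))]
    have : ∀ U : Matrix.unitaryGroup (Fin D) ℂ, (∑ i, ∑ k, (U : Matrix (Fin D) (Fin D) ℂ) i j *
        (U : Matrix (Fin D) (Fin D) ℂ) k l * star ((U : Matrix (Fin D) (Fin D) ℂ) k n) *
        star ((U : Matrix (Fin D) (Fin D) ℂ) i s)) = if j = s ∧ l = n then 1 else 0 := by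
      intro U
      rw [show (if j = s ∧ l = n then (1:ℂ) else 0) =
        (if j = s then 1 else 0) * (if l = n then 1 else 0) by split_ifs <;> simp_all,
        ← unit_col U j s, ← unit_col U l n, Finset.sum_mul_sum]
      refine Finset.sum_congr rfl fun i _ => Finset.sum_congr rfl fun k _ => by ring
    simp only [this]
    simp
  have hs : ∀ i : Fin D, ∑ k : Fin D, (if i = k ∧ k = i then (1:ℂ) else 0) = 1 := by
    intro i
    rw [Finset.sum_eq_single i] <;> simp +contextual [eq_comm]
  simp only [hab, Finset.sum_add_distrib, ← Finset.mul_sum, hs] at c1 c2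
  simp only [and_self, if_true, Finset.sum_const, Finset.card_univ, Fintype.card_fin,
    nsmul_eq_mul, mul_one] at c1 c2
  have hD0 : (D : ℂ) ≠ 0 := by
    have : D ≠ 0 := by omega
    exact_mod_cast this
  have hD1 : (D : ℂ)^2 - 1 ≠ 0 := by
    have h : D^2 ≠ 1 := by nlinarith
    rw [sub_ne_zero]
    exact_mod_cast h
  rw [hab, ← c1, ← c2]
  field_simp
  ring

end TwirlAux

theorem mesProj_entry (D : ℕ) (a b c d : Fin D) :
    mesProj (Fin D) (a, b) (c, d) =
      (D : ℂ)⁻¹ * ((if a = b then 1 else 0) * (if c = d then 1 else 0)) := by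
  have h : ((((Real.sqrt D)⁻¹ : ℝ) : ℂ)) * (((Real.sqrt D)⁻¹ : ℝ) : ℂ) = (D : ℂ)⁻¹ := by
    rw [← Complex.ofReal_mul, ← mul_inv, Real.mul_self_sqrt (Nat.cast_nonneg D)]
    simp
  rw [← h]
  simp only [mesProj, mesVec, vecMulVec_apply, Pi.star_apply, Fintype.card_fin]
  split_ifs <;> simp

theorem twirl_entry (D : ℕ) (U : Matrix (Fin D) (Fin D) ℂ) (p q : I4 D) :
    (uOn14 D U * mes12mes34 D * (uOn14 D U)ᴴ) p q = ((D : ℂ)^2)⁻¹ *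
      (U p.1 p.2.1 * U q.2.2.2 q.2.2.1 * star (U p.2.2.2 p.2.2.1) * star (U q.1 q.2.1)) := by
  have hl : ∀ b : I4 D, (uOn14 D U * mes12mes34 D) p b =
      ((D : ℂ)^2)⁻¹ * (U p.1 p.2.1 * star (U p.2.2.2 p.2.2.1)) *
        ((if b.1 = b.2.1 then 1 else 0) * (if b.2.2.1 = b.2.2.2 then 1 else 0)) := by
    intro b
    obtain ⟨p1, p2, p3, p4⟩ := p
    rw [Matrix.mul_apply, Finset.sum_eq_single (p2, p2, p3, p3)]
    · simp only [uOn14, mes12mes34, Matrix.of_apply, mesProj_entry, if_true, starRingEnd_apply]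
      ring
    · rintro ⟨a1, a2, a3, a4⟩ _ ha
      simp only [uOn14, mes12mes34, Matrix.of_apply, mesProj_entry]
      by_cases h2 : p2 = a2
      · by_cases h3 : p3 = a3
        · by_cases h1 : a1 = a2
          · by_cases h4 : a3 = a4
            · exact absurd (by rw [h1, ← h4, h2, h3]) ha
            · simp [h4]
          · simp [h1]
        · simp [h3]
      · simp [h2]
    · simp
  rw [Matrix.mul_apply]
  simp only [hl]
  obtain ⟨q1, q2, q3, q4⟩ := q
  rw [Finset.sum_eq_single (q2, q2, q3, q3)]
  · simp only [uOn14, conjTranspose_apply, Matrix.of_apply, if_true, starRingEnd_apply,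
      star_mul', star_one, star_star]
    ring
  · rintro ⟨a1, a2, a3, a4⟩ _ ha
    simp only [uOn14, conjTranspose_apply, Matrix.of_apply]
    by_cases h2 : q2 = a2
    · by_cases h3 : q3 = a3
      · by_cases h1 : a1 = a2
        · by_cases h4 : a3 = a4
          · exact absurd (by rw [h1, ← h4, h2, h3]) ha
          · simp [h4]
        · simp [h1]
      · simp [h3]
    · simp [h2]
  · simp

/-- **entanglement swapping by twirling.** For `D ≥ 2`,
`(T₁₄ ⊗ id₂₃)(Φ⁺₁₂ ⊗ Φ⁺₃₄) = (1/D²) Φ⁺₁₄ ⊗ Φ⁺₂₃ + ((D²−1)/D²) π⁻₁₄ ⊗ π⁻₂₃`,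
where `T₁₄` is the Haar twirl `M ↦ ∫ (U ⊗ Ū) M (U ⊗ Ū)† dμ(U)` on systems 1 and 4. -/
theorem twirl_entanglement_swapping (D : ℕ) (hD : 2 ≤ D)
    [MeasurableSpace (Matrix.unitaryGroup (Fin D) ℂ)]
    [BorelSpace (Matrix.unitaryGroup (Fin D) ℂ)]
    (μ : Measure (Matrix.unitaryGroup (Fin D) ℂ))
    [μ.IsHaarMeasure] [IsProbabilityMeasure μ] :
    ∀ p q : I4 D,
      (∫ U : Matrix.unitaryGroup (Fin D) ℂ,
          (uOn14 D (U : Matrix (Fin D) (Fin D) ℂ) * mes12mes34 D *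
            (uOn14 D (U : Matrix (Fin D) (Fin D) ℂ))ᴴ) p q ∂μ)
        = (((D : ℂ)) ^ 2)⁻¹ *
            (mesProj (Fin D) (p.1, p.2.2.2) (q.1, q.2.2.2) *
              mesProj (Fin D) (p.2.1, p.2.2.1) (q.2.1, q.2.2.1)) +
          (((D : ℂ) ^ 2 - 1) / (D : ℂ) ^ 2) *
            (mesOrth (Fin D) (p.1, p.2.2.2) (q.1, q.2.2.2) *
              mesOrth (Fin D) (p.2.1, p.2.2.1) (q.2.1, q.2.2.1)) := by
  intro p q
  simp only [twirl_entry]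
  rw [integral_const_mul]
  have h := twMom_eq μ hD p.2.1 q.2.2.1 p.2.2.1 q.2.1 p.1 q.2.2.2 p.2.2.2 q.1
  unfold twMom at h
  rw [h]
  obtain ⟨p1, p2, p3, p4⟩ := p
  obtain ⟨q1, q2, q3, q4⟩ := q
  have hD0 : (D : ℂ) ≠ 0 := by
    have : D ≠ 0 := by omega
    exact_mod_cast this
  have hD1 : (D : ℂ)^2 - 1 ≠ 0 := by
    have h : D^2 ≠ 1 := by nlinarith
    rw [sub_ne_zero]
    exact_mod_cast h
  have hand : ∀ P Q : Prop, ∀ [Decidable P] [Decidable Q],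
      (if P ∧ Q then (1:ℂ) else 0) = (if P then 1 else 0) * (if Q then 1 else 0) := by
    intro P Q _ _
    split_ifs <;> simp_all
  simp only [mesOrth, mesProj_entry, Matrix.smul_apply, Matrix.sub_apply, Matrix.one_apply,
    Prod.mk.injEq, hand, smul_eq_mul, Fintype.card_fin, eq_comm (a := q4), eq_comm (a := q3)]
  field_simp
  ring
end
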